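/- For any i ∈ [n−1], the following three identities hold in k[S_n]: [t_i, t_{i+1}] = t_i (t_{i+1} − (t_i − 1)), and [t_i, t_{i+1}] · t_i = 0, and [t_i, t_{i+1}]² = 0. -/

import Mathlib

/-- The simple transposition `s_i ∈ S_n` (1-based indexing), swapping `i` and `i+1`,
defined as the identity for `i` outside `{1, …, n-1}`. -/
def simpleTransposition (n i : ℕ) : Equiv.Perm (Fin n) :=
  if h : 1 ≤ i ∧ i < n then
    Equiv.swap ⟨i - 1, by omega⟩ ⟨i, h.2⟩
  else 1

/-- The cycle `(v ⟹ w) = s_v s_{v+1} ⋯ s_{w-1} ∈ S_n`, sending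
`v ↦ v+1 ↦ ⋯ ↦ w ↦ v` (and equal to the identity when `v = w`). -/
def cyc (n v w : ℕ) : Equiv.Perm (Fin n) :=
  ((List.range' v (w - v)).map (simpleTransposition n)).prod

/-- The somewhere-to-below shuffle `t_ℓ = Σ_{w=ℓ}^{n} (ℓ ⟹ w)` in the group
algebra `R[S_n]`. -/
noncomputable def t (R : Type*) [CommRing R] (n ℓ : ℕ) :
    MonoidAlgebra R (Equiv.Perm (Fin n)) :=
  ∑ w ∈ Finset.Icc ℓ n, MonoidAlgebra.of R (Equiv.Perm (Fin n)) (cyc n ℓ w)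

theorem simpleTransposition_mul_self (n i : ℕ) :
    simpleTransposition n i * simpleTransposition n i = 1 := by
  unfold simpleTransposition
  split_ifs <;> simp

theorem simpleTransposition_comm (n i j : ℕ) (h : i + 2 ≤ j) :
    simpleTransposition n i * simpleTransposition n j
      = simpleTransposition n j * simpleTransposition n i := by
  unfold simpleTransposition
  split_ifs with hi hj
  · refine Equiv.Perm.Disjoint.commute ?_
    rw [Equiv.Perm.disjoint_iff_disjoint_support, Equiv.Perm.support_swap,
      Equiv.Perm.support_swap]
    all_goals simp [Fin.ext_iff]; omega
  all_goals simp

theorem simpleTransposition_braid (n i : ℕ) (hi : 1 ≤ i) (h : i + 1 < n) :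
    simpleTransposition n i * simpleTransposition n (i + 1) * simpleTransposition n i
      = simpleTransposition n (i + 1) * simpleTransposition n i
        * simpleTransposition n (i + 1) := by
  unfold simpleTransposition
  rw [dif_pos (show 1 ≤ i ∧ i < n by omega), dif_pos (show 1 ≤ i + 1 ∧ i + 1 < n by omega)]
  simp only [Nat.add_sub_cancel]
  generalize ha : (⟨i - 1, _⟩ : Fin n) = a
  generalize hb : (⟨i, _⟩ : Fin n) = b
  generalize hc : (⟨i + 1, _⟩ : Fin n) = c
  have hab : a ≠ b := by rw [← ha, ← hb, Ne, Fin.mk.injEq]; omega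
  have hac : a ≠ c := by rw [← ha, ← hc, Ne, Fin.mk.injEq]; omega
  have hbc : b ≠ c := by rw [← hb, ← hc, Ne, Fin.mk.injEq]; omega
  have hl := Equiv.swap_mul_swap_mul_swap hbc.symm hac.symm
  rw [Equiv.swap_comm b a, Equiv.swap_comm c b] at hl
  rw [hl, Equiv.swap_mul_swap_mul_swap hab hac, Equiv.swap_comm]

theorem cyc_self (n v : ℕ) : cyc n v v = 1 := by
  simp [cyc]

theorem cyc_eq_simpleTransposition_mul (n v w : ℕ) (h : v < w) :
    cyc n v w = simpleTransposition n v * cyc n (v + 1) w := by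
  obtain ⟨d, rfl⟩ := Nat.exists_eq_add_of_lt h
  simp [cyc, show v + d + 1 - v = d + 1 by omega, show v + d + 1 - (v + 1) = d by omega,
    List.range'_succ]

theorem cyc_succ_right (n v w : ℕ) (h : v ≤ w) :
    cyc n v (w + 1) = cyc n v w * simpleTransposition n w := by
  obtain ⟨d, rfl⟩ := Nat.exists_eq_add_of_le h
  simp [cyc, show v + d + 1 - v = d + 1 by omega, List.range'_concat]

theorem simpleTransposition_comm_cyc (n i v w : ℕ) (h : i + 2 ≤ v) :
    simpleTransposition n i * cyc n v w = cyc n v w * simpleTransposition n i := by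
  refine Commute.list_prod_right _ _ fun g hg => ?_
  simp only [List.mem_map, List.mem_range'_1] at hg
  obtain ⟨j, hj, rfl⟩ := hg
  exact simpleTransposition_comm n i j (by omega)

theorem cyc_mul_simpleTransposition (n i j w : ℕ) (hi : 1 ≤ i) (hij : i ≤ j) (hjw : j + 1 < w)
    (hw : w ≤ n) :
    cyc n i w * simpleTransposition n j = simpleTransposition n (j + 1) * cyc n i w := by
  induction hij using Nat.decreasingInduction with
  | self =>
    rw [cyc_eq_simpleTransposition_mul n j w (by omega),
      cyc_eq_simpleTransposition_mul n (j + 1) w (by omega), mul_assoc, mul_assoc,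
      ← simpleTransposition_comm_cyc n j (j + 1 + 1) w (by omega), ← mul_assoc, ← mul_assoc,
      simpleTransposition_braid n j hi (by omega)]
    simp only [mul_assoc]
  | of_succ k hk ih =>
    rw [cyc_eq_simpleTransposition_mul n k w (by omega), mul_assoc, ih (by omega), ← mul_assoc,
      simpleTransposition_comm n k (j + 1) (by omega), mul_assoc]

/-- Conjugation by `(i ⟹ w)` shifts the shorter cycle `(i ⟹ v)` to `(i + 1 ⟹ v + 1)`. -/
theorem cyc_mul_cyc_of_lt (n i v w : ℕ) (hi : 1 ≤ i) (hiv : i ≤ v) (hvw : v < w) (hw : w ≤ n) :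
    cyc n i w * cyc n i v = cyc n (i + 1) (v + 1) * cyc n i w := by
  induction v, hiv using Nat.le_induction with
  | base => simp [cyc_self]
  | succ v hv ih =>
    rw [cyc_succ_right n i v hv, ← mul_assoc, ih (by omega), mul_assoc,
      cyc_mul_simpleTransposition n i v w hi hv hvw hw, ← mul_assoc,
      ← cyc_succ_right n (i + 1) (v + 1) (by omega)]

/-- The counterpart of `cyc_mul_cyc_of_lt` when the left cycle is the shorter one. -/
theorem cyc_mul_cyc_of_le (n i v w : ℕ) (hi : 1 ≤ i) (hiw : i < w) (hwv : w ≤ v) (hv : v ≤ n) :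
    cyc n i w * cyc n i v = cyc n (i + 1) v * cyc n i (w - 1) := by
  have h := cyc_mul_cyc_of_lt n i (w - 1) v hi (by omega) (by omega) hv
  rw [show w - 1 + 1 = w by omega, cyc_eq_simpleTransposition_mul n i v (by omega)] at h
  rw [cyc_eq_simpleTransposition_mul n i w hiw, cyc_eq_simpleTransposition_mul n i v (by omega),
    mul_assoc, ← h, ← mul_assoc, ← mul_assoc, simpleTransposition_mul_self, one_mul]

theorem t_eq_one_add (R : Type*) [CommRing R] (n i : ℕ) (hin : i ≤ n) :
    t R n i = 1 + ∑ w ∈ Finset.Icc (i + 1) n,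
      MonoidAlgebra.of R (Equiv.Perm (Fin n)) (cyc n i w) := by
  rw [t, ← Finset.insert_Icc_succ_left_eq_Icc hin, Finset.sum_insert (by simp), cyc_self, map_one]
  rfl

theorem t_succ_mul_t (R : Type*) [CommRing R] (n i : ℕ) (hi : 1 ≤ i) (hin : i ≤ n) :
    t R n (i + 1) * t R n i = t R n i * (t R n i - 1) := by
  have hcomm : t R n i * (t R n i - 1) = (t R n i - 1) * t R n i := by noncomm_ring
  have hsub : t R n i - 1 = ∑ w ∈ Finset.Icc (i + 1) n,
      MonoidAlgebra.of R (Equiv.Perm (Fin n)) (cyc n i w) := by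
    rw [t_eq_one_add R n i hin, add_sub_cancel_left]
  rw [hcomm, hsub, t, t, Finset.sum_mul_sum, Finset.sum_mul_sum, ← Finset.sum_product',
    ← Finset.sum_product']
  let φ : ℕ × ℕ → ℕ × ℕ := fun p => if p.2 < p.1 then (p.2 + 1, p.1) else (p.2, p.1 - 1)
  have hmem : ∀ p ∈ Finset.Icc (i + 1) n ×ˢ Finset.Icc i n,
      φ p ∈ Finset.Icc (i + 1) n ×ˢ Finset.Icc i n := by
    rintro ⟨w, v⟩ hp
    simp only [Finset.mem_product, Finset.mem_Icc, φ] at hp ⊢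
    split_ifs <;> dsimp only <;> omega
  have hinv : ∀ p ∈ Finset.Icc (i + 1) n ×ˢ Finset.Icc i n, φ (φ p) = p := by
    rintro ⟨w, v⟩ hp
    simp only [Finset.mem_product, Finset.mem_Icc] at hp
    by_cases h : v < w
    · simp [φ, h, show ¬ w < v + 1 by omega]
    · simp [φ, h, show w - 1 < v by omega, show w - 1 + 1 = w by omega]
  refine (Finset.sum_nbij' φ φ hmem hmem hinv hinv ?_).symm
  rintro ⟨w, v⟩ hp
  simp only [Finset.mem_product, Finset.mem_Icc] at hp
  rw [← map_mul, ← map_mul]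
  by_cases h : v < w
  · simp only [φ, h, if_true]
    rw [cyc_mul_cyc_of_lt n i v w hi (by omega) h (by omega)]
  · simp only [φ, h, if_false]
    rw [cyc_mul_cyc_of_le n i v w hi (by omega) (by omega) (by omega)]

theorem comm_ti_ti_succ_identities
    (R : Type*) [CommRing R] (n : ℕ) (hn : 0 < n)
    (i : ℕ) (hi1 : 1 ≤ i) (hin : i ≤ n - 1) :
    (t R n i * t R n (i + 1) - t R n (i + 1) * t R n i
        = t R n i * (t R n (i + 1) - (t R n i - 1))) ∧
    ((t R n i * t R n (i + 1) - t R n (i + 1) * t R n i) * t R n i = 0) ∧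
    ((t R n i * t R n (i + 1) - t R n (i + 1) * t R n i) ^ 2 = 0) := by
  have key := t_succ_mul_t R n i hi1 (by omega)
  have comm_eq : t R n i * t R n (i + 1) - t R n (i + 1) * t R n i
      = t R n i * (t R n (i + 1) - (t R n i - 1)) := by
    rw [key, ← mul_sub]
  have comm_mul : (t R n i * t R n (i + 1) - t R n (i + 1) * t R n i) * t R n i = 0 := by
    rw [sub_mul, mul_assoc, key]
    noncomm_ring
  refine ⟨comm_eq, comm_mul, ?_⟩
  rw [sq]
  nth_rewrite 2 [comm_eq]
  rw [← mul_assoc, comm_mul, zero_mul]
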